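/- (Gradient and time derivative estimates for a continuous solution) Assume (A0) and (A1) and let T > 0. Let u = (u^α) be any function on [0,T]×J that is a locally uniform limit, along a sequence ε = (Δt, Δx) → 0 satisfying the CFL condition (CFL′), of the numerical solutions of the scheme (NS) initialized by U^{α,0}_i = u₀^α(iΔx). Then for all a ≥ 0, all 0 ≤ t ≤ t+a ≤ T, all x ≥ 0 and all α = 1,…,N: a·m⁰₀ ≤ u^α(t+a, x) − u^α(t, x) ≤ a·M⁰₀ and a·p̲⁰_α ≤ u^α(t, x+a) − u^α(t, x) ≤ a·p̄⁰_α. -/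

import Mathlib

open Set Filter

/-- Assumption (A1) for a single Hamiltonian: `H` is `C¹`, coercive
(`H p → +∞` as `|p| → +∞`), non-increasing on `(-∞, p₀]` and non-decreasing on `[p₀, +∞)`. -/
def A1cond (H : ℝ → ℝ) (p₀ : ℝ) : Prop :=
  ContDiff ℝ 1 H ∧ Tendsto H (cocompact ℝ) atTop ∧
    AntitoneOn H (Iic p₀) ∧ MonotoneOn H (Ici p₀)

/-- The non-increasing envelope `H⁻` of `H` with turning point `p₀`. -/
noncomputable def Hm (H : ℝ → ℝ) (p₀ : ℝ) (p : ℝ) : ℝ :=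
  if p ≤ p₀ then H p else H p₀

/-- The non-decreasing envelope `H⁺` of `H` with turning point `p₀`. -/
noncomputable def Hp (H : ℝ → ℝ) (p₀ : ℝ) (p : ℝ) : ℝ :=
  if p ≤ p₀ then H p₀ else H p

/-- One time step of the numerical scheme (NS) on the junction:
`V` (the values at time `n+1`) is computed from `U` (the values at time `n`).
For `i ≥ 1` on each branch `α` the update uses
`max (H⁺_α(p_{i,-}), H⁻_α(p_{i,+}))`; at the junction point `i = 0` all branches share a
common value and the update uses `max_β H⁻_β(p^β_{0,+})`. -/
def SchemeStep {N : ℕ} (H : Fin N → ℝ → ℝ) (p₀ : Fin N → ℝ) (Δx Δt : ℝ)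
    (U V : Fin N → ℕ → ℝ) : Prop :=
  (∀ (α : Fin N) (i : ℕ), 1 ≤ i →
      V α i = U α i - Δt * max (Hp (H α) (p₀ α) ((U α i - U α (i - 1)) / Δx))
        (Hm (H α) (p₀ α) ((U α (i + 1) - U α i) / Δx))) ∧
  (∀ α β : Fin N, U α 0 = U β 0) ∧
  (∀ α : Fin N, V α 0 = U α 0 - Δt *
      sSup (Set.range fun β : Fin N => Hm (H β) (p₀ β) ((U β 1 - U β 0) / Δx)))

/-- The numerical scheme (NS): `U α n i` is the value on branch `α` at time step `n`
and grid point `i`. -/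
def SchemeNS {N : ℕ} (H : Fin N → ℝ → ℝ) (p₀ : Fin N → ℝ) (Δx Δt : ℝ)
    (U : Fin N → ℕ → ℕ → ℝ) : Prop :=
  ∀ n : ℕ, SchemeStep H p₀ Δx Δt (fun α i => U α n i) (fun α i => U α (n + 1) i)

/-- Viscosity subsolution of the Hamilton–Jacobi equation (HJ) on the junction, on
`J_T = (0,T) × J`. The junction is encoded by the family of branch restrictions
`u α t x` (`x ≥ 0`), sharing a common value at the junction point `x = 0`. -/
def IsViscSubSol {N : ℕ} (T : ℝ) (H : Fin N → ℝ → ℝ) (p₀ : Fin N → ℝ)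
    (u : Fin N → ℝ → ℝ → ℝ) : Prop :=
  (∀ α, UpperSemicontinuousOn (fun q : ℝ × ℝ => u α q.1 q.2) (Ico 0 T ×ˢ Ici 0)) ∧
  (∀ (α β : Fin N) (t : ℝ), u α t 0 = u β t 0) ∧
  (∀ φ : Fin N → ℝ → ℝ → ℝ,
    (∀ α, ContDiffOn ℝ 1 (fun q : ℝ × ℝ => φ α q.1 q.2) (Ioo 0 T ×ˢ Ici 0)) →
    (∀ (α β : Fin N) (t : ℝ), φ α t 0 = φ β t 0) →
    (∀ (β : Fin N) (t x : ℝ), t ∈ Ioo 0 T → 0 ≤ x → u β t x ≤ φ β t x) →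
    ((∀ (α : Fin N) (t x : ℝ), t ∈ Ioo 0 T → 0 < x → u α t x = φ α t x →
        deriv (fun s => φ α s x) t
          + H α (derivWithin (fun y => φ α t y) (Ici 0) x) ≤ 0) ∧
     (∀ t : ℝ, t ∈ Ioo 0 T → (∀ α : Fin N, u α t 0 = φ α t 0) → ∀ α : Fin N,
        deriv (fun s => φ α s 0) t
          + sSup (Set.range fun β : Fin N =>
              Hm (H β) (p₀ β) (derivWithin (fun y => φ β t y) (Ici 0) 0)) ≤ 0)))

/-- Viscosity supersolution of (HJ) on the junction, on `J_T = (0,T) × J`. -/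
def IsViscSuperSol {N : ℕ} (T : ℝ) (H : Fin N → ℝ → ℝ) (p₀ : Fin N → ℝ)
    (u : Fin N → ℝ → ℝ → ℝ) : Prop :=
  (∀ α, LowerSemicontinuousOn (fun q : ℝ × ℝ => u α q.1 q.2) (Ico 0 T ×ˢ Ici 0)) ∧
  (∀ (α β : Fin N) (t : ℝ), u α t 0 = u β t 0) ∧
  (∀ φ : Fin N → ℝ → ℝ → ℝ,
    (∀ α, ContDiffOn ℝ 1 (fun q : ℝ × ℝ => φ α q.1 q.2) (Ioo 0 T ×ˢ Ici 0)) →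
    (∀ (α β : Fin N) (t : ℝ), φ α t 0 = φ β t 0) →
    (∀ (β : Fin N) (t x : ℝ), t ∈ Ioo 0 T → 0 ≤ x → φ β t x ≤ u β t x) →
    ((∀ (α : Fin N) (t x : ℝ), t ∈ Ioo 0 T → 0 < x → u α t x = φ α t x →
        0 ≤ deriv (fun s => φ α s x) t
          + H α (derivWithin (fun y => φ α t y) (Ici 0) x)) ∧
     (∀ t : ℝ, t ∈ Ioo 0 T → (∀ α : Fin N, u α t 0 = φ α t 0) → ∀ α : Fin N,
        0 ≤ deriv (fun s => φ α s 0) t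
          + sSup (Set.range fun β : Fin N =>
              Hm (H β) (p₀ β) (derivWithin (fun y => φ β t y) (Ici 0) 0)))))

/-- Viscosity subsolution of (HJ)-(CI): subsolution of (HJ) on `J_T` with
`u(0,·) ≤ u₀` on `J`. -/
def IsViscSubSolCI {N : ℕ} (T : ℝ) (H : Fin N → ℝ → ℝ) (p₀ : Fin N → ℝ)
    (u₀ : Fin N → ℝ → ℝ) (u : Fin N → ℝ → ℝ → ℝ) : Prop :=
  IsViscSubSol T H p₀ u ∧ ∀ (α : Fin N) (x : ℝ), 0 ≤ x → u α 0 x ≤ u₀ α x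

/-- Viscosity supersolution of (HJ)-(CI): supersolution of (HJ) on `J_T` with
`u(0,·) ≥ u₀` on `J`. -/
def IsViscSuperSolCI {N : ℕ} (T : ℝ) (H : Fin N → ℝ → ℝ) (p₀ : Fin N → ℝ)
    (u₀ : Fin N → ℝ → ℝ) (u : Fin N → ℝ → ℝ → ℝ) : Prop :=
  IsViscSuperSol T H p₀ u ∧ ∀ (α : Fin N) (x : ℝ), 0 ≤ x → u₀ α x ≤ u α 0 x

/-- Viscosity solution of (HJ)-(CI) on `[0,T) × J`. -/
def IsViscSolCI {N : ℕ} (T : ℝ) (H : Fin N → ℝ → ℝ) (p₀ : Fin N → ℝ)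
    (u₀ : Fin N → ℝ → ℝ) (u : Fin N → ℝ → ℝ → ℝ) : Prop :=
  IsViscSubSolCI T H p₀ u₀ u ∧ IsViscSuperSolCI T H p₀ u₀ u

/-- Assumption (A0): Lipschitz initial data on each branch, with a common value at the
junction point. -/
def A0cond {N : ℕ} (u₀ : Fin N → ℝ → ℝ) : Prop :=
  (∀ α, ∃ C : NNReal, LipschitzOnWith C (u₀ α) (Ici 0)) ∧
  (∀ α β : Fin N, u₀ α 0 = u₀ β 0)

/-- Assumption (A1′): each `H_α` is the Legendre–Fenchel transform of a uniformly convex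
`C²` Lagrangian `L_α`, and `H⁻_α`, `H⁺_α` are the corresponding one-sided transforms. -/
def A1primeCond {N : ℕ} (H : Fin N → ℝ → ℝ) (p₀ : Fin N → ℝ) : Prop :=
  ∃ (γ : ℝ) (L : Fin N → ℝ → ℝ), 0 < γ ∧
    (∀ α, ContDiff ℝ 2 (L α)) ∧
    (∀ (α : Fin N) (q : ℝ), γ ≤ deriv (deriv (L α)) q) ∧
    (∀ (α : Fin N) (p : ℝ), H α p = sSup (Set.range fun q : ℝ => p * q - L α q)) ∧
    (∀ (α : Fin N) (p : ℝ),
      Hm (H α) (p₀ α) p = sSup ((fun q : ℝ => p * q - L α q) '' Iic 0)) ∧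
    (∀ (α : Fin N) (p : ℝ),
      Hp (H α) (p₀ α) p = sSup ((fun q : ℝ => p * q - L α q) '' Ici 0))

/-- The CFL condition (CFL′) for the scheme (NS): `Δx/Δt` dominates `|H'_α|` on
`[p̲_α, p̄_α]`, where `p̲_α, p̄_α` are determined by the level `-m⁰`,
`m⁰ = inf_{β,i} W^{β,0}_i`. -/
def CFLprime {N : ℕ} (H : Fin N → ℝ → ℝ) (p₀ : Fin N → ℝ) (Δx Δt : ℝ)
    (U : Fin N → ℕ → ℕ → ℝ) : Prop :=
  ∀ α : Fin N, ∀ p ∈ Icc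
      (sInf {p : ℝ | Hm (H α) (p₀ α) p =
        -(sInf (Set.range fun q : Fin N × ℕ => (U q.1 1 q.2 - U q.1 0 q.2) / Δt))})
      (sSup {p : ℝ | Hp (H α) (p₀ α) p =
        -(sInf (Set.range fun q : Fin N × ℕ => (U q.1 1 q.2 - U q.1 0 q.2) / Δt))}),
    |deriv (H α) p| ≤ Δx / Δt

lemma Hm_eq_min (H : ℝ → ℝ) (p₀ p : ℝ) : Hm H p₀ p = H (min p p₀) := by
  unfold Hm
  split_ifs with h
  · rw [min_eq_left h]
  · rw [min_eq_right (le_of_not_ge h)]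

lemma Hp_eq_Hm_neg (H : ℝ → ℝ) (p₀ p : ℝ) :
    Hp H p₀ p = Hm (fun q => H (-q)) (-p₀) (-p) := by
  unfold Hp Hm
  rcases lt_trichotomy p p₀ with h | h | h
  · simp [h.le, h.not_ge]
  · simp [h]
  · simp [h.le, h.not_ge]

lemma A1cond.neg {H : ℝ → ℝ} {p₀ : ℝ} (h : A1cond H p₀) :
    A1cond (fun q => H (-q)) (-p₀) := by
  obtain ⟨h1, h2, h3, h4⟩ := h
  refine ⟨h1.comp contDiff_neg,
    h2.comp (Homeomorph.neg ℝ).isClosedEmbedding.tendsto_cocompact, ?_, ?_⟩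
  · intro a ha b hb hab
    simp only [mem_Iic] at ha hb
    exact h4 (mem_Ici.2 (by linarith)) (mem_Ici.2 (by linarith)) (by linarith)
  · intro a ha b hb hab
    simp only [mem_Ici] at ha hb
    exact h3 (mem_Iic.2 (by linarith)) (mem_Iic.2 (by linarith)) (by linarith)

lemma sSup_Hp_level (H : ℝ → ℝ) (p₀ c : ℝ) :
    sSup {p : ℝ | Hp H p₀ p = c} =
      -sInf {p : ℝ | Hm (fun q => H (-q)) (-p₀) p = c} := by
  rw [Real.sInf_def, neg_neg]
  congr 1
  ext p
  simp [Hp_eq_Hm_neg]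

namespace A1cond

variable {H : ℝ → ℝ} {p₀ : ℝ}

lemma antitone_Hm (h : A1cond H p₀) : Antitone (Hm H p₀) := by
  intro a b hab
  rw [Hm_eq_min, Hm_eq_min]
  exact h.2.2.1 (mem_Iic.2 (min_le_right _ _)) (mem_Iic.2 (min_le_right _ _)) (min_le_min_right _ hab)

lemma monotone_Hp (h : A1cond H p₀) : Monotone (Hp H p₀) := by
  intro a b hab
  rw [Hp_eq_Hm_neg, Hp_eq_Hm_neg]
  exact h.neg.antitone_Hm (neg_le_neg hab)

lemma le_Hm (h : A1cond H p₀) (p : ℝ) : H p₀ ≤ Hm H p₀ p := by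
  rw [Hm_eq_min]
  exact h.2.2.1 (mem_Iic.2 (min_le_right _ _)) (mem_Iic.2 le_rfl) (min_le_right _ _)

lemma Hm_le (h : A1cond H p₀) (p : ℝ) : Hm H p₀ p ≤ H p := by
  unfold Hm
  split_ifs with hp
  · exact le_rfl
  · exact h.2.2.2 (mem_Ici.2 le_rfl) (mem_Ici.2 (le_of_not_ge hp)) (le_of_not_ge hp)

lemma Hp_le (h : A1cond H p₀) (p : ℝ) : Hp H p₀ p ≤ H p := by
  rw [Hp_eq_Hm_neg]
  simpa using h.neg.Hm_le (-p)

lemma min_le (h : A1cond H p₀) (p : ℝ) : H p₀ ≤ H p := (h.le_Hm p).trans (h.Hm_le p)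

/-- The infimum of a level set of `H⁻` is attained, lies to the left of the turning point and
bounds the corresponding sublevel set from below. -/
lemma sInf_level (h : A1cond H p₀) {c : ℝ} (hc : H p₀ ≤ c) :
    sInf {p : ℝ | Hm H p₀ p = c} ≤ p₀ ∧ Hm H p₀ (sInf {p : ℝ | Hm H p₀ p = c}) = c ∧
      ∀ p, Hm H p₀ p ≤ c → sInf {p : ℝ | Hm H p₀ p = c} ≤ p := by
  have hcont : Continuous (Hm H p₀) := by
    have : Hm H p₀ = fun p => H (min p p₀) := funext (Hm_eq_min H p₀)
    rw [this]
    exact h.1.continuous.comp (continuous_id.min continuous_const)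
  have hbot : Tendsto H atBot atTop := h.2.1.mono_left atBot_le_cocompact
  obtain ⟨A, hA⟩ := eventually_atBot.1 (hbot.eventually (eventually_gt_atTop c))
  have hlt : ∀ p, p ≤ A → c < Hm H p₀ p := fun p hp => by
    rw [Hm_eq_min]
    exact hA _ ((min_le_left _ _).trans hp)
  set S := {p : ℝ | Hm H p₀ p = c} with hS
  have hbdd : BddBelow S := ⟨A, fun p hp => by
    by_contra hcon
    exact (hlt p (le_of_not_ge hcon)).ne' hp⟩
  have hAp : A ≤ p₀ := by
    by_contra hcon
    exact absurd (hA p₀ (le_of_not_ge hcon)) (not_lt.2 hc)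
  have hp₀ : Hm H p₀ p₀ = H p₀ := by simp [Hm_eq_min]
  obtain ⟨q, hq, hqc⟩ : c ∈ Hm H p₀ '' Icc A p₀ :=
    intermediate_value_Icc' hAp hcont.continuousOn ⟨by rw [hp₀]; exact hc, (hlt A le_rfl).le⟩
  have hmem : sInf S ∈ S :=
    (isClosed_eq hcont continuous_const).csInf_mem ⟨q, hqc⟩ hbdd
  refine ⟨(csInf_le hbdd hqc).trans hq.2, hmem, fun p hp => ?_⟩
  by_contra hcon
  rw [not_le] at hcon
  have h1 : c ≤ Hm H p₀ p := hmem.symm.le.trans (h.antitone_Hm hcon.le)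
  exact absurd (csInf_le hbdd (show p ∈ S from le_antisymm hp h1)) (not_le.2 hcon)

lemma Hm_sub_le (h : A1cond H p₀) {l K : ℝ} (hK : ∀ p ∈ Icc l p₀, |deriv H p| ≤ K)
    {a b : ℝ} (hl : l ≤ p₀) (hla : l ≤ a) (hab : a ≤ b) :
    Hm H p₀ a - Hm H p₀ b ≤ K * (b - a) := by
  rw [Hm_eq_min, Hm_eq_min]
  have hK0 : 0 ≤ K := (abs_nonneg _).trans (hK l ⟨le_rfl, hl⟩)
  have hmin : min a p₀ ≤ min b p₀ := min_le_min_right _ hab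
  have hlip := (convex_Icc l p₀).norm_image_sub_le_of_norm_deriv_le (f := H) (C := K)
    (fun x _ => (h.1.differentiable one_ne_zero) x) (fun x hx => by simpa using hK x hx)
    (x := min b p₀) (y := min a p₀)
    ⟨le_min (hla.trans hab) hl, min_le_right _ _⟩ ⟨le_min hla hl, min_le_right _ _⟩
  rw [Real.norm_eq_abs, Real.norm_eq_abs, abs_sub_comm (min a p₀),
    abs_of_nonneg (sub_nonneg.2 hmin)] at hlip
  refine (le_abs_self _).trans (hlip.trans (mul_le_mul_of_nonneg_left ?_ hK0))
  rcases le_total a p₀ with h1 | h1 <;> rcases le_total b p₀ with h2 | h2 <;>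
    simp [h1, h2] <;> linarith

end A1cond

/-- An antitone `f` attains the level `c` at `l`, the left end of its sublevel set, and decreases
at rate at most `K` to the right of `l`. -/
structure LevelBarrier (f : ℝ → ℝ) (K c l : ℝ) : Prop where
  anti : Antitone f
  level : f l = c
  le_of_le : ∀ p, f p ≤ c → l ≤ p
  sub_le : ∀ a b, l ≤ a → a ≤ b → f a - f b ≤ K * (b - a)

namespace LevelBarrier

variable {f : ℝ → ℝ} {K m l : ℝ}

lemma step_lower (h : LevelBarrier f K (-m) l) (hK : 0 < K) {p w w' : ℝ}
    (hp : f p ≤ -w) (hw : m ≤ w) (hw' : m ≤ w') : f (p + (w' - w) / K) ≤ -m := by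
  have hlp : l ≤ p := h.le_of_le p (by linarith)
  have h1 := h.sub_le l p le_rfl hlp
  rw [h.level] at h1
  have h2 : l ≤ p + (w' - w) / K := by
    have : -(p - l) ≤ (w' - w) / K := by
      rw [le_div_iff₀ hK]
      linarith
    linarith
  exact (h.anti h2).trans h.level.le

lemma step_upper (h : LevelBarrier f K (-m) l) (hK : 0 < K) {p w w' M : ℝ}
    (hp : f p = -w) (hw : m ≤ w) (hwM : w ≤ M) (hw' : w' ≤ M) :
    -M ≤ f (p + (w' - w) / K) := by
  have hlp : l ≤ p := h.le_of_le p (by linarith)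
  have h0 : 0 ≤ (M - w) / K := div_nonneg (by linarith) hK.le
  have h1 := h.sub_le p (p + (M - w) / K) hlp (by linarith)
  have h2 : K * (p + (M - w) / K - p) = M - w := by field_simp; ring
  have h3 : p + (w' - w) / K ≤ p + (M - w) / K := by gcongr
  have h4 := h.anti h3
  linarith

end LevelBarrier

lemma A1cond.levelBarrier {H : ℝ → ℝ} {p₀ : ℝ} (h : A1cond H p₀) {K c : ℝ} (hc : H p₀ ≤ c)
    (hK : ∀ p ∈ Icc (sInf {p : ℝ | Hm H p₀ p = c}) p₀, |deriv H p| ≤ K) :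
    LevelBarrier (Hm H p₀) K c (sInf {p : ℝ | Hm H p₀ p = c}) where
  anti := h.antitone_Hm
  level := (h.sInf_level hc).2.1
  le_of_le := (h.sInf_level hc).2.2
  sub_le _ _ ha hab := h.Hm_sub_le hK (h.sInf_level hc).1 ha hab

/-- Both one-sided envelopes satisfy the barrier property when `|H'| ≤ K` between the extreme
points of the level sets. -/
lemma A1cond.levelBarriers {H : ℝ → ℝ} {p₀ : ℝ} (h : A1cond H p₀) {K c : ℝ} (hc : H p₀ ≤ c)
    (hK : ∀ p ∈ Icc (sInf {p : ℝ | Hm H p₀ p = c}) (sSup {p : ℝ | Hp H p₀ p = c}),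
      |deriv H p| ≤ K) :
    (∃ l, LevelBarrier (Hm H p₀) K c l) ∧ ∃ l, LevelBarrier (fun p => Hp H p₀ (-p)) K c l := by
  have hc' : (fun q => H (-q)) (-p₀) ≤ c := by simpa using hc
  have hl := (h.sInf_level hc).1
  have hr := (h.neg.sInf_level hc').1
  rw [sSup_Hp_level] at hK
  refine ⟨⟨_, h.levelBarrier hc fun p hp => hK p ⟨hp.1, by linarith [hp.2]⟩⟩,
    ⟨sInf {p : ℝ | Hm (fun q => H (-q)) (-p₀) p = c}, ?_⟩⟩
  have heq : (fun p => Hp H p₀ (-p)) = Hm (fun q => H (-q)) (-p₀) := by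
    funext p
    rw [Hp_eq_Hm_neg, neg_neg]
  rw [heq]
  refine h.neg.levelBarrier hc' fun p hp => ?_
  rw [deriv_comp_neg, abs_neg]
  exact hK _ ⟨by linarith [hp.2], by linarith [hp.1]⟩

section Scheme

variable {N : ℕ} {H : Fin N → ℝ → ℝ} {p₀ : Fin N → ℝ} {Δx Δt : ℝ} {U V : Fin N → ℕ → ℝ}

lemma SchemeStep.sub_div_succ (h : SchemeStep H p₀ Δx Δt U V) (hΔt : 0 < Δt)
    (α : Fin N) (i : ℕ) :
    (V α (i + 1) - U α (i + 1)) / Δt =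
      -max (Hp (H α) (p₀ α) ((U α (i + 1) - U α i) / Δx))
        (Hm (H α) (p₀ α) ((U α (i + 1 + 1) - U α (i + 1)) / Δx)) := by
  have := h.1 α (i + 1) (by omega)
  rw [this, Nat.add_sub_cancel]
  field_simp
  ring

lemma SchemeStep.sub_div_zero (h : SchemeStep H p₀ Δx Δt U V) (hΔt : 0 < Δt) (α : Fin N) :
    (V α 0 - U α 0) / Δt =
      -sSup (Set.range fun β : Fin N => Hm (H β) (p₀ β) ((U β 1 - U β 0) / Δx)) := by
  rw [h.2.2 α]
  field_simp
  ring

lemma SchemeStep.Hm_le (h : SchemeStep H p₀ Δx Δt U V) (hΔt : 0 < Δt) (α : Fin N) (i : ℕ) :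
    Hm (H α) (p₀ α) ((U α (i + 1) - U α i) / Δx) ≤ -((V α i - U α i) / Δt) := by
  cases i with
  | zero =>
    rw [h.sub_div_zero hΔt α, neg_neg]
    exact le_csSup (finite_range _).bddAbove ⟨α, rfl⟩
  | succ i =>
    rw [h.sub_div_succ hΔt α i, neg_neg]
    exact le_max_right _ _

lemma SchemeStep.Hp_le (h : SchemeStep H p₀ Δx Δt U V) (hΔt : 0 < Δt) (α : Fin N) (i : ℕ) :
    Hp (H α) (p₀ α) ((U α (i + 1) - U α i) / Δx) ≤ -((V α (i + 1) - U α (i + 1)) / Δt) := by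
  rw [h.sub_div_succ hΔt α i, neg_neg]
  exact le_max_left _ _

lemma SchemeStep.grad_succ (hΔx : 0 < Δx) (hΔt : 0 < Δt) (α : Fin N) (i : ℕ) :
    (V α (i + 1) - V α i) / Δx = (U α (i + 1) - U α i) / Δx +
      ((V α (i + 1) - U α (i + 1)) / Δt - (V α i - U α i) / Δt) / (Δx / Δt) := by
  field_simp
  ring

/-- One step of the scheme preserves a lower bound `m` on the discrete time derivative. -/
lemma SchemeStep.lower_step {Z : Fin N → ℕ → ℝ} {m : ℝ} {l r : Fin N → ℝ}
    (hUV : SchemeStep H p₀ Δx Δt U V) (hVZ : SchemeStep H p₀ Δx Δt V Z)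
    (hΔx : 0 < Δx) (hΔt : 0 < Δt)
    (hl : ∀ α, LevelBarrier (Hm (H α) (p₀ α)) (Δx / Δt) (-m) (l α))
    (hr : ∀ α, LevelBarrier (fun p => Hp (H α) (p₀ α) (-p)) (Δx / Δt) (-m) (r α))
    (hm : ∀ α i, m ≤ (V α i - U α i) / Δt) (α : Fin N) (i : ℕ) :
    m ≤ (Z α i - V α i) / Δt := by
  have hK : 0 < Δx / Δt := div_pos hΔx hΔt
  have hminus : ∀ β j, Hm (H β) (p₀ β) ((V β (j + 1) - V β j) / Δx) ≤ -m := fun β j => by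
    rw [SchemeStep.grad_succ (U := U) hΔx hΔt]
    exact (hl β).step_lower hK (hUV.Hm_le hΔt β j) (hm β j) (hm β (j + 1))
  have hplus : ∀ β j, Hp (H β) (p₀ β) ((V β (j + 1) - V β j) / Δx) ≤ -m := fun β j => by
    have := (hr β).step_lower hK (p := -((U β (j + 1) - U β j) / Δx))
      (by simpa using hUV.Hp_le hΔt β j) (hm β (j + 1)) (hm β j)
    rw [SchemeStep.grad_succ (U := U) hΔx hΔt]
    convert this using 2
    ring
  cases i with
  | zero =>
    rw [hVZ.sub_div_zero hΔt α, le_neg]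
    have : Nonempty (Fin N) := ⟨α⟩
    exact csSup_le (range_nonempty _) (by rintro _ ⟨β, rfl⟩; exact hminus β 0)
  | succ i =>
    rw [hVZ.sub_div_succ hΔt α i, le_neg]
    exact max_le (hplus α i) (hminus α (i + 1))

/-- One step of the scheme preserves an upper bound `M` on the discrete time derivative. -/
lemma SchemeStep.upper_step {Z : Fin N → ℕ → ℝ} {m M : ℝ} {l r : Fin N → ℝ}
    (hUV : SchemeStep H p₀ Δx Δt U V) (hVZ : SchemeStep H p₀ Δx Δt V Z)
    (hΔx : 0 < Δx) (hΔt : 0 < Δt)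
    (hl : ∀ α, LevelBarrier (Hm (H α) (p₀ α)) (Δx / Δt) (-m) (l α))
    (hr : ∀ α, LevelBarrier (fun p => Hp (H α) (p₀ α) (-p)) (Δx / Δt) (-m) (r α))
    (hm : ∀ α i, m ≤ (V α i - U α i) / Δt) (hM : ∀ α i, (V α i - U α i) / Δt ≤ M)
    (α : Fin N) (i : ℕ) : (Z α i - V α i) / Δt ≤ M := by
  have hK : 0 < Δx / Δt := div_pos hΔx hΔt
  have hminus : ∀ β j, Hm (H β) (p₀ β) ((U β (j + 1) - U β j) / Δx) =
      -((V β j - U β j) / Δt) → -M ≤ Hm (H β) (p₀ β) ((V β (j + 1) - V β j) / Δx) :=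
    fun β j h => by
      rw [SchemeStep.grad_succ (U := U) hΔx hΔt]
      exact (hl β).step_upper hK h (hm β j) (hM β j) (hM β (j + 1))
  cases i with
  | zero =>
    have : Nonempty (Fin N) := ⟨α⟩
    obtain ⟨β, hβ⟩ := (range_nonempty fun β : Fin N =>
      Hm (H β) (p₀ β) ((U β 1 - U β 0) / Δx)).csSup_mem (finite_range _)
    have h1 := hminus β 0 (by
      rw [hUV.sub_div_zero hΔt β, neg_neg]
      exact hβ)
    have h2 := hVZ.Hm_le hΔt β 0
    have h3 : (Z α 0 - V α 0) / Δt = (Z β 0 - V β 0) / Δt := by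
      rw [hVZ.sub_div_zero hΔt α, hVZ.sub_div_zero hΔt β]
    linarith
  | succ i =>
    have hW := hUV.sub_div_succ hΔt α i
    rcases max_choice (Hp (H α) (p₀ α) ((U α (i + 1) - U α i) / Δx))
      (Hm (H α) (p₀ α) ((U α (i + 1 + 1) - U α (i + 1)) / Δx)) with h | h
    · rw [h] at hW
      have h1 := (hr α).step_upper hK (p := -((U α (i + 1) - U α i) / Δx))
        (w := (V α (i + 1) - U α (i + 1)) / Δt) (by rw [hW]; simp)
        (hm α (i + 1)) (hM α (i + 1)) (hM α i)
      have h2 : -M ≤ Hp (H α) (p₀ α) ((V α (i + 1) - V α i) / Δx) := by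
        rw [SchemeStep.grad_succ (U := U) hΔx hΔt]
        convert h1 using 2
        ring
      have h3 := hVZ.Hp_le hΔt α i
      linarith
    · rw [h] at hW
      have h1 := hminus α (i + 1) (by rw [hW, neg_neg])
      have h2 := hVZ.Hm_le hΔt α (i + 1)
      linarith

end Scheme

/-- Under the CFL condition, bounds on the initial discrete time derivative propagate. -/
lemma SchemeNS.time_derivative_bounds {N : ℕ} {H : Fin N → ℝ → ℝ} {p₀ : Fin N → ℝ}
    (hA1 : ∀ α, A1cond (H α) (p₀ α)) {Δx Δt : ℝ} (hΔx : 0 < Δx) (hΔt : 0 < Δt)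
    {U : Fin N → ℕ → ℕ → ℝ} (hU : SchemeNS H p₀ Δx Δt U) (hCFL : CFLprime H p₀ Δx Δt U)
    {m M : ℝ} (hm : ∀ α i, m ≤ (U α 1 i - U α 0 i) / Δt)
    (hM : ∀ α i, (U α 1 i - U α 0 i) / Δt ≤ M) (n : ℕ) (α : Fin N) (i : ℕ) :
    m ≤ (U α (n + 1) i - U α n i) / Δt ∧ (U α (n + 1) i - U α n i) / Δt ≤ M := by
  set W := fun q : Fin N × ℕ => (U q.1 1 q.2 - U q.1 0 q.2) / Δt with hW
  have hbdd : BddBelow (range W) := ⟨m, by rintro _ ⟨q, rfl⟩; exact hm q.1 q.2⟩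
  have hmin : ∀ β i, sInf (range W) ≤ (U β 1 i - U β 0 i) / Δt := fun β i =>
    csInf_le hbdd ⟨(β, i), rfl⟩
  have hc : ∀ β, H β (p₀ β) ≤ -sInf (range W) := fun β => by
    have h1 := (hU 0).Hm_le hΔt β 0
    have h2 := (hA1 β).le_Hm ((U β 0 (0 + 1) - U β 0 0) / Δx)
    have h3 := hmin β 0
    simp only [zero_add] at h1 h2 h3
    linarith
  have hbar := fun β => (hA1 β).levelBarriers (hc β) (hCFL β)
  choose l hl using fun β => (hbar β).1
  choose r hr using fun β => (hbar β).2
  have hlow : ∀ n β i, sInf (range W) ≤ (U β (n + 1) i - U β n i) / Δt := by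
    intro n
    induction n with
    | zero => exact hmin
    | succ n ih => exact (hU n).lower_step (hU (n + 1)) hΔx hΔt hl hr ih
  have hup : ∀ n β i, (U β (n + 1) i - U β n i) / Δt ≤ M := by
    intro n
    induction n with
    | zero => exact hM
    | succ n ih => exact (hU n).upper_step (hU (n + 1)) hΔx hΔt hl hr (hlow n) ih
  refine ⟨le_trans ?_ (hlow n α i), hup n α i⟩
  exact le_csInf ⟨_, (α, 0), rfl⟩ (by rintro _ ⟨q, rfl⟩; exact hm q.1 q.2)

lemma mul_le_sub_of_forall_succ {a : ℕ → ℝ} {h c : ℝ} (hh : 0 < h)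
    (hc : ∀ n, c ≤ (a (n + 1) - a n) / h) {n k : ℕ} (hnk : n ≤ k) :
    ((k : ℝ) * h - n * h) * c ≤ a k - a n := by
  induction k, hnk using Nat.le_induction with
  | base => simp
  | succ k _ ih =>
    have h1 := hc k
    rw [le_div_iff₀ hh] at h1
    push_cast
    linarith

lemma sub_le_mul_of_forall_succ {a : ℕ → ℝ} {h c : ℝ} (hh : 0 < h)
    (hc : ∀ n, (a (n + 1) - a n) / h ≤ c) {n k : ℕ} (hnk : n ≤ k) :
    a k - a n ≤ ((k : ℝ) * h - n * h) * c := by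
  have := mul_le_sub_of_forall_succ (a := fun n => -a n) (c := -c) hh (fun n => by
    have h1 := hc n
    rw [show (-a (n + 1) - -a n) / h = -((a (n + 1) - a n) / h) by ring]
    linarith) hnk
  linarith

lemma floor_div_mul_le {x h : ℝ} (hx : 0 ≤ x) (hh : 0 < h) : (⌊x / h⌋₊ : ℝ) * h ≤ x := by
  rw [← le_div_iff₀ hh]
  exact Nat.floor_le (div_nonneg hx hh.le)

lemma tendsto_floor_div_mul {h : ℕ → ℝ} (hpos : ∀ k, 0 < h k) (h0 : Tendsto h atTop (nhds 0))
    {x : ℝ} (hx : 0 ≤ x) :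
    Tendsto (fun k => (⌊x / h k⌋₊ : ℝ) * h k) atTop (nhds x) := by
  refine tendsto_of_tendsto_of_tendsto_of_le_of_le
    (by simpa using (tendsto_const_nhds (x := x)).sub h0) tendsto_const_nhds
    (fun k => ?_) (fun k => floor_div_mul_le hx (hpos k))
  have h1 := Nat.lt_floor_add_one (x / h k)
  rw [div_lt_iff₀ (hpos k)] at h1
  simp only
  linarith

/-- Sampling a locally uniformly convergent family of grid functions at the grid points nearest
below `(t, x)` recovers the continuous limit at `(t, x)`. -/
lemma tendsto_grid_sample {T : ℝ} {Δx Δt : ℕ → ℝ} (hΔx : ∀ k, 0 < Δx k) (hΔt : ∀ k, 0 < Δt k)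
    (hΔx0 : Tendsto Δx atTop (nhds 0)) (hΔt0 : Tendsto Δt atTop (nhds 0))
    {U : ℕ → ℕ → ℕ → ℝ} {u : ℝ → ℝ → ℝ}
    (hu : ContinuousOn (fun q : ℝ × ℝ => u q.1 q.2) (Icc 0 T ×ˢ Ici 0))
    (hconv : ∀ R δ : ℝ, 0 < δ → ∃ K : ℕ, ∀ k, K ≤ k → ∀ n i : ℕ,
      (n : ℝ) * Δt k ≤ T → (i : ℝ) * Δx k ≤ R →
        |u ((n : ℝ) * Δt k) ((i : ℝ) * Δx k) - U k n i| ≤ δ)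
    {t x : ℝ} (ht : 0 ≤ t) (htT : t ≤ T) (hx : 0 ≤ x) :
    Tendsto (fun k => U k ⌊t / Δt k⌋₊ ⌊x / Δx k⌋₊) atTop (nhds (u t x)) := by
  have hgrid : Tendsto (fun k => ((⌊t / Δt k⌋₊ : ℝ) * Δt k, (⌊x / Δx k⌋₊ : ℝ) * Δx k)) atTop
      (nhdsWithin (t, x) (Icc 0 T ×ˢ Ici 0)) := by
    refine tendsto_nhdsWithin_iff.2 ⟨(tendsto_floor_div_mul hΔt hΔt0 ht).prodMk_nhds
      (tendsto_floor_div_mul hΔx hΔx0 hx), Eventually.of_forall fun k => ?_⟩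
    exact ⟨⟨mul_nonneg (Nat.cast_nonneg _) (hΔt k).le,
      (floor_div_mul_le ht (hΔt k)).trans htT⟩, mul_nonneg (Nat.cast_nonneg _) (hΔx k).le⟩
  have h1 := (hu (t, x) ⟨⟨ht, htT⟩, hx⟩).tendsto.comp hgrid
  have h2 : Tendsto (fun k => u ((⌊t / Δt k⌋₊ : ℝ) * Δt k) ((⌊x / Δx k⌋₊ : ℝ) * Δx k) -
      U k ⌊t / Δt k⌋₊ ⌊x / Δx k⌋₊) atTop (nhds 0) := by
    rw [Metric.tendsto_atTop]
    intro ε hε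
    obtain ⟨K, hK⟩ := hconv x (ε / 2) (half_pos hε)
    refine ⟨K, fun k hk => ?_⟩
    rw [Real.dist_eq, sub_zero]
    have := hK k hk ⌊t / Δt k⌋₊ ⌊x / Δx k⌋₊ ((floor_div_mul_le ht (hΔt k)).trans htT)
      (floor_div_mul_le hx (hΔx k))
    linarith
  simpa using h1.sub h2

/-- **Gradient and time derivative estimates for a continuous solution** (Corollary 2.6).
Assume (A0) and (A1) and let `T > 0`. Let `u` be a (continuous) locally uniform limit,
along a sequence of mesh parameters `ε_k = (Δt_k, Δx_k) → 0` each satisfying the CFL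
condition (CFL′), of the numerical solutions of the scheme (NS) initialized by
`U^{α,0}_i = u₀^α(iΔx_k)`. Then for all `a ≥ 0`, `0 ≤ t ≤ t + a ≤ T`, `x ≥ 0` and `α`:
`a·m⁰₀ ≤ u^α(t+a,x) − u^α(t,x) ≤ a·M⁰₀` and `a·p̲⁰_α ≤ u^α(t,x+a) − u^α(t,x) ≤ a·p̄⁰_α`. -/
theorem continuous_solution_estimates {N : ℕ} (hN : 1 ≤ N)
    (H : Fin N → ℝ → ℝ) (p₀ : Fin N → ℝ)
    (hA1 : ∀ α, A1cond (H α) (p₀ α))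
    (u₀ : Fin N → ℝ → ℝ) (hA0 : A0cond u₀)
    (Lm Lp : Fin N → ℝ)
    (hLp : ∀ α, IsLeast
      {L : ℝ | ∀ x a : ℝ, 0 ≤ x → 0 ≤ a → u₀ α (x + a) - u₀ α x ≤ a * L} (Lp α))
    (hLm : ∀ α, IsGreatest
      {L : ℝ | ∀ x a : ℝ, 0 ≤ x → 0 ≤ a → a * L ≤ u₀ α (x + a) - u₀ α x} (Lm α))
    (m00 M00 : ℝ)
    (hm00 : m00 = sInf {v : ℝ | ∃ (α : Fin N) (p : ℝ),
      Lm α ≤ p ∧ p ≤ Lp α ∧ v = -(H α p)})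
    (hM00 : M00 = max
      (sSup (Set.range fun α : Fin N =>
        min (-(Hp (H α) (p₀ α) (Lm α))) (-(Hm (H α) (p₀ α) (Lp α)))))
      (sInf (Set.range fun α : Fin N => -(Hm (H α) (p₀ α) (Lp α)))))
    (plow0 pbar0 : Fin N → ℝ)
    (hplow0 : ∀ α, plow0 α = sInf {p : ℝ | Hm (H α) (p₀ α) p = -m00})
    (hpbar0 : ∀ α, pbar0 α = sSup {p : ℝ | Hp (H α) (p₀ α) p = -m00})
    (T : ℝ) (hT : 0 < T)
    (Δx Δt : ℕ → ℝ)
    (hΔx : ∀ k, 0 < Δx k) (hΔt : ∀ k, 0 < Δt k)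
    (hΔx0 : Tendsto Δx atTop (nhds 0)) (hΔt0 : Tendsto Δt atTop (nhds 0))
    (U : ℕ → Fin N → ℕ → ℕ → ℝ)
    (hU : ∀ k, SchemeNS H p₀ (Δx k) (Δt k) (U k))
    (hinit : ∀ k (α : Fin N) (i : ℕ), U k α 0 i = u₀ α (i * Δx k))
    (hCFL : ∀ k, CFLprime H p₀ (Δx k) (Δt k) (U k))
    (u : Fin N → ℝ → ℝ → ℝ)
    (hu_cont : ∀ α, ContinuousOn (fun q : ℝ × ℝ => u α q.1 q.2) (Icc 0 T ×ˢ Ici 0))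
    (hconv : ∀ R δ : ℝ, 0 < δ →
      ∃ K : ℕ, ∀ k, K ≤ k → ∀ (α : Fin N) (n i : ℕ),
        (n : ℝ) * Δt k ≤ T → (i : ℝ) * Δx k ≤ R →
        |u α ((n : ℝ) * Δt k) ((i : ℝ) * Δx k) - U k α n i| ≤ δ) :
    ∀ (α : Fin N) (t x a : ℝ), 0 ≤ a → 0 ≤ t → t + a ≤ T → 0 ≤ x →
      (a * m00 ≤ u α (t + a) x - u α t x ∧ u α (t + a) x - u α t x ≤ a * M00) ∧
      (a * plow0 α ≤ u α t (x + a) - u α t x ∧ u α t (x + a) - u α t x ≤ a * pbar0 α) := by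
  have hbdd : BddBelow {v : ℝ | ∃ (α : Fin N) (p : ℝ), Lm α ≤ p ∧ p ≤ Lp α ∧ v = -(H α p)} := by
    have h1 : BddBelow (⋃ α : Fin N, (fun p => -(H α p)) '' Icc (Lm α) (Lp α)) :=
      (isCompact_iUnion fun α =>
        isCompact_Icc.image (hA1 α).1.continuous.neg).bddBelow
    refine h1.mono ?_
    rintro v ⟨α, p, h, h', rfl⟩
    exact mem_iUnion.2 ⟨α, p, ⟨h, h'⟩, rfl⟩
  have hHle : ∀ α p, Lm α ≤ p → p ≤ Lp α → H α p ≤ -m00 := fun α p h h' => by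
    have := csInf_le hbdd ⟨α, p, h, h', rfl⟩
    rw [← hm00] at this
    linarith
  have hgrad : ∀ k α i, Lm α ≤ (U k α 0 (i + 1) - U k α 0 i) / Δx k ∧
      (U k α 0 (i + 1) - U k α 0 i) / Δx k ≤ Lp α := fun k α i => by
    have hx0 : 0 ≤ (i : ℝ) * Δx k := mul_nonneg (Nat.cast_nonneg _) (hΔx k).le
    have h1 := (hLm α).1 (i * Δx k) (Δx k) hx0 (hΔx k).le
    have h2 := (hLp α).1 (i * Δx k) (Δx k) hx0 (hΔx k).le
    rw [le_div_iff₀ (hΔx k), div_le_iff₀ (hΔx k), hinit, hinit]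
    push_cast
    rw [add_one_mul]
    exact ⟨by linarith, by linarith⟩
  have hmin : ∀ α, H α (p₀ α) ≤ -m00 := fun α =>
    ((hA1 α).min_le _).trans (hHle α _ (hgrad 0 α 0).1 (hgrad 0 α 0).2)
  have hlow : ∀ k α i, m00 ≤ (U k α 1 i - U k α 0 i) / Δt k := fun k α i => by
    have hminus : ∀ β j, Hm (H β) (p₀ β) ((U k β 0 (j + 1) - U k β 0 j) / Δx k) ≤ -m00 :=
      fun β j => ((hA1 β).Hm_le _).trans (hHle β _ (hgrad k β j).1 (hgrad k β j).2)
    cases i with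
    | zero =>
      have h := (hU k 0).sub_div_zero (hΔt k) α
      simp only [zero_add] at h
      rw [h, le_neg]
      exact csSup_le ⟨_, α, rfl⟩ (by rintro _ ⟨β, rfl⟩; exact hminus β 0)
    | succ i =>
      have h := (hU k 0).sub_div_succ (hΔt k) α i
      simp only [zero_add] at h
      rw [h, le_neg]
      exact max_le (((hA1 α).Hp_le _).trans (hHle α _ (hgrad k α i).1 (hgrad k α i).2))
        (hminus α (i + 1))
  have hup : ∀ k α i, (U k α 1 i - U k α 0 i) / Δt k ≤ M00 := fun k α i => by
    cases i with
    | zero =>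
      have h := (hU k 0).sub_div_zero (hΔt k) α
      simp only [zero_add] at h
      rw [h, hM00]
      refine le_max_of_le_right (le_csInf ⟨_, α, rfl⟩ ?_)
      rintro _ ⟨β, rfl⟩
      refine neg_le_neg (((hA1 β).antitone_Hm (hgrad k β 0).2).trans ?_)
      exact le_csSup (finite_range fun β : Fin N =>
        Hm (H β) (p₀ β) ((U k β 0 1 - U k β 0 0) / Δx k)).bddAbove ⟨β, rfl⟩
    | succ i =>
      have h := (hU k 0).sub_div_succ (hΔt k) α i
      simp only [zero_add] at h
      rw [h, hM00]
      refine le_max_of_le_left (le_trans ?_ (le_csSup (finite_range _).bddAbove ⟨α, rfl⟩))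
      exact le_min
        (neg_le_neg (((hA1 α).monotone_Hp (hgrad k α i).1).trans (le_max_left _ _)))
        (neg_le_neg (((hA1 α).antitone_Hm (hgrad k α (i + 1)).2).trans (le_max_right _ _)))
  have htime := fun k =>
    (hU k).time_derivative_bounds hA1 (hΔx k) (hΔt k) (hCFL k) (hlow k) (hup k)
  have hspace : ∀ k n α i, plow0 α ≤ (U k α n (i + 1) - U k α n i) / Δx k ∧
      (U k α n (i + 1) - U k α n i) / Δx k ≤ pbar0 α := fun k n α i => by
    have h1 := (hU k n).Hm_le (hΔt k) α i
    have h2 := (hU k n).Hp_le (hΔt k) α i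
    have h3 := (htime k n α i).1
    have h4 := (htime k n α (i + 1)).1
    constructor
    · rw [hplow0]
      exact ((hA1 α).sInf_level (hmin α)).2.2 _ (by linarith)
    · rw [hpbar0, sSup_Hp_level, le_neg]
      rw [Hp_eq_Hm_neg] at h2
      exact ((hA1 α).neg.sInf_level (by simpa using hmin α)).2.2 _ (by linarith)
  intro α t x a ha ht htT hx
  have hlim : ∀ s y : ℝ, 0 ≤ s → s ≤ T → 0 ≤ y →
      Tendsto (fun k => U k α ⌊s / Δt k⌋₊ ⌊y / Δx k⌋₊) atTop (nhds (u α s y)) :=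
    fun s y hs hsT hy => tendsto_grid_sample hΔx hΔt hΔx0 hΔt0 (U := fun k => U k α) (hu_cont α)
      (fun R δ hδ => (hconv R δ hδ).imp fun K hK k hk => hK k hk α) hs hsT hy
  have hstep : ∀ (h : ℕ → ℝ), (∀ k, 0 < h k) → Tendsto h atTop (nhds 0) → ∀ s c : ℝ, 0 ≤ s →
      Tendsto (fun k => ((⌊(s + a) / h k⌋₊ : ℝ) * h k - (⌊s / h k⌋₊ : ℝ) * h k) * c) atTop
        (nhds (a * c)) := fun h hpos h0 s c hs => by
    have := ((tendsto_floor_div_mul hpos h0 (add_nonneg hs ha)).sub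
      (tendsto_floor_div_mul hpos h0 hs)).mul_const c
    simpa using this
  have hmono : ∀ (h : ℕ → ℝ), (∀ k, 0 < h k) → ∀ s k, ⌊s / h k⌋₊ ≤ ⌊(s + a) / h k⌋₊ :=
    fun h hpos s k => Nat.floor_mono (div_le_div_of_nonneg_right (by linarith) (hpos k).le)
  have ht' : t ≤ T := by linarith
  have hdt := (hlim (t + a) x (by linarith) htT hx).sub (hlim t x ht ht' hx)
  have hdx := (hlim t (x + a) ht ht' (by linarith)).sub (hlim t x ht ht' hx)
  refine ⟨⟨le_of_tendsto_of_tendsto' (hstep Δt hΔt hΔt0 t m00 ht) hdt fun k => ?_,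
    le_of_tendsto_of_tendsto' hdt (hstep Δt hΔt hΔt0 t M00 ht) fun k => ?_⟩,
    ⟨le_of_tendsto_of_tendsto' (hstep Δx hΔx hΔx0 x (plow0 α) hx) hdx fun k => ?_,
    le_of_tendsto_of_tendsto' hdx (hstep Δx hΔx hΔx0 x (pbar0 α) hx) fun k => ?_⟩⟩
  · exact mul_le_sub_of_forall_succ (a := fun n => U k α n ⌊x / Δx k⌋₊) (hΔt k)
      (fun n => (htime k n α _).1) (hmono Δt hΔt t k)
  · exact sub_le_mul_of_forall_succ (a := fun n => U k α n ⌊x / Δx k⌋₊) (hΔt k)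
      (fun n => (htime k n α _).2) (hmono Δt hΔt t k)
  · exact mul_le_sub_of_forall_succ (a := fun i => U k α ⌊t / Δt k⌋₊ i) (hΔx k)
      (fun i => (hspace k _ α i).1) (hmono Δx hΔx x k)
  · exact sub_le_mul_of_forall_succ (a := fun i => U k α ⌊t / Δt k⌋₊ i) (hΔx k)
      (fun i => (hspace k _ α i).2) (hmono Δx hΔx x k)
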